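/- Let η be a parameter vector with all components positive, suppose M_η is nonempty, and suppose that for every i = 1, …, n the partial derivative ∂_iF(η) exists, i.e., ∂_i⁻F(η) = ∂_i⁺F(η). Then the values ψ_i(x_η) and φ(x_η) are the same for every minimizer x_η ∈ M_η, and for every x_η ∈ M_η one has ψ_i(x_η) = ∂_iF(η) for each i and φ(x_η) = F(η) − Σ_{i=1}^n η_i ∂_iF(η). -/

import Mathlib

open Filter Set Topology

/-- The value function `F(η) = inf_{x ∈ Q} (φ(x) + Σ_i η_i ψ_i(x))` of
multi-parameter Tikhonov regularization. -/
noncomputable def valueFun {X : Type*} {n : ℕ} (Q : Set X) (φ : X → ℝ)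
    (ψ : Fin n → X → ℝ) (η : Fin n → ℝ) : ℝ :=
  sInf ((fun x => φ x + ∑ i, η i * ψ i x) '' Q)

/-- `HasDPlus F η i D` says that the right-sided partial derivative
`∂_i⁺F(η) = lim_{h→0⁺} (F(η + h eᵢ) - F(η))/h` exists and equals `D`. -/
def HasDPlus {n : ℕ} (F : (Fin n → ℝ) → ℝ) (η : Fin n → ℝ) (i : Fin n) (D : ℝ) : Prop :=
  Filter.Tendsto (fun h : ℝ => (F (η + h • (Pi.single i 1 : Fin n → ℝ)) - F η) / h)
    (nhdsWithin 0 (Set.Ioi 0)) (nhds D)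

/-- `HasDMinus F η i D` says that the left-sided partial derivative
`∂_i⁻F(η) = lim_{h→0⁺} (F(η) - F(η - h eᵢ))/h` exists and equals `D`. -/
def HasDMinus {n : ℕ} (F : (Fin n → ℝ) → ℝ) (η : Fin n → ℝ) (i : Fin n) (D : ℝ) : Prop :=
  Filter.Tendsto (fun h : ℝ => (F η - F (η - h • (Pi.single i 1 : Fin n → ℝ))) / h)
    (nhdsWithin 0 (Set.Ioi 0)) (nhds D)

/-- The set `M_η` of minimizers of the Tikhonov functional `J_η` over `Q`. -/
def minSet {X : Type*} {n : ℕ} (Q : Set X) (φ : X → ℝ) (ψ : Fin n → X → ℝ)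
    (η : Fin n → ℝ) : Set X :=
  {x | x ∈ Q ∧ ∀ z ∈ Q, φ x + ∑ i, η i * ψ i x ≤ φ z + ∑ i, η i * ψ i z}

theorem valueFun_le {X : Type*} {n : ℕ} {Q : Set X} {φ : X → ℝ} (hφ : ∀ x, 0 ≤ φ x)
    {ψ : Fin n → X → ℝ} (hψ : ∀ i x, 0 ≤ ψ i x) {η : Fin n → ℝ} (hη : ∀ i, 0 ≤ η i)
    {x : X} (hx : x ∈ Q) : valueFun Q φ ψ η ≤ φ x + ∑ i, η i * ψ i x := by
  refine csInf_le ⟨0, ?_⟩ ⟨x, hx, rfl⟩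
  rintro _ ⟨z, -, rfl⟩
  exact add_nonneg (hφ z) (Finset.sum_nonneg fun i _ => mul_nonneg (hη i) (hψ i z))

theorem valueFun_eq_of_mem_minSet {X : Type*} {n : ℕ} {Q : Set X} {φ : X → ℝ}
    {ψ : Fin n → X → ℝ} {η : Fin n → ℝ} {x : X} (hx : x ∈ minSet Q φ ψ η) :
    valueFun Q φ ψ η = φ x + ∑ i, η i * ψ i x := by
  refine IsLeast.csInf_eq ⟨⟨x, hx.1, rfl⟩, ?_⟩
  rintro _ ⟨z, hz, rfl⟩
  exact hx.2 z hz

theorem sum_add_smul_single_mul {n : ℕ} (η a : Fin n → ℝ) (i : Fin n) (t : ℝ) :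
    ∑ j, (η + t • (Pi.single i 1 : Fin n → ℝ)) j * a j = ∑ j, η j * a j + t * a i := by
  simp [add_mul, Finset.sum_add_distrib, Pi.single_apply]

/-- At a minimizer `x` of `J_η`, the value function lies below its linearization along `eᵢ`
with slope `ψ i x`. -/
theorem valueFun_add_smul_single_le {X : Type*} {n : ℕ} {Q : Set X} {φ : X → ℝ}
    (hφ : ∀ x, 0 ≤ φ x) {ψ : Fin n → X → ℝ} (hψ : ∀ i x, 0 ≤ ψ i x) {η : Fin n → ℝ}
    (hη : ∀ i, 0 ≤ η i) {x : X} (hx : x ∈ minSet Q φ ψ η) {i : Fin n} {t : ℝ}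
    (ht : 0 ≤ η i + t) :
    valueFun Q φ ψ (η + t • (Pi.single i 1 : Fin n → ℝ)) ≤ valueFun Q φ ψ η + t * ψ i x := by
  rw [valueFun_eq_of_mem_minSet hx, add_assoc, ← sum_add_smul_single_mul η (fun j => ψ j x)]
  refine valueFun_le hφ hψ (fun j => ?_) hx.1
  obtain rfl | hj := eq_or_ne j i
  · simpa using ht
  · simpa [hj] using hη j

theorem HasDPlus.le_of_mem_minSet {X : Type*} {n : ℕ} {Q : Set X} {φ : X → ℝ}
    (hφ : ∀ x, 0 ≤ φ x) {ψ : Fin n → X → ℝ} (hψ : ∀ i x, 0 ≤ ψ i x) {η : Fin n → ℝ}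
    (hη : ∀ i, 0 ≤ η i) {x : X} (hx : x ∈ minSet Q φ ψ η) {i : Fin n} {d : ℝ}
    (hd : HasDPlus (valueFun Q φ ψ) η i d) : d ≤ ψ i x := by
  refine le_of_tendsto hd ?_
  filter_upwards [self_mem_nhdsWithin] with h (hpos : 0 < h)
  rw [div_le_iff₀ hpos]
  linarith [valueFun_add_smul_single_le hφ hψ hη hx (add_nonneg (hη i) hpos.le)]

theorem HasDMinus.ge_of_mem_minSet {X : Type*} {n : ℕ} {Q : Set X} {φ : X → ℝ}
    (hφ : ∀ x, 0 ≤ φ x) {ψ : Fin n → X → ℝ} (hψ : ∀ i x, 0 ≤ ψ i x) {η : Fin n → ℝ}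
    (hη : ∀ i, 0 < η i) {x : X} (hx : x ∈ minSet Q φ ψ η) {i : Fin n} {d : ℝ}
    (hd : HasDMinus (valueFun Q φ ψ) η i d) : ψ i x ≤ d := by
  refine ge_of_tendsto hd ?_
  filter_upwards [Ioo_mem_nhdsGT (hη i)] with h hh
  rw [le_div_iff₀ hh.1, sub_eq_add_neg η, ← neg_smul]
  have ht : 0 ≤ η i + -h := by linarith [hh.2]
  linarith [valueFun_add_smul_single_le hφ hψ (fun j => (hη j).le) hx ht]

/-- if all partial derivatives `∂_iF(η)` exist (both one-sided derivatives
coincide), then `ψ i` and `φ` are single valued on `M_η`, with `ψ i x_η = ∂_iF(η)` and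
`φ x_η = F(η) − Σ_i η_i ∂_iF(η)` for every minimizer `x_η ∈ M_η`. -/
theorem single_valued_of_differentiable {X : Type*} {n : ℕ} (Q : Set X) (hQ : Q.Nonempty)
    (φ : X → ℝ) (hφ : ∀ x, 0 ≤ φ x)
    (ψ : Fin n → X → ℝ) (hψ : ∀ i x, 0 ≤ ψ i x)
    (η : Fin n → ℝ) (hη : ∀ i, 0 < η i)
    (hne : (minSet Q φ ψ η).Nonempty)
    (D : Fin n → ℝ)
    (hD : ∀ i, HasDMinus (valueFun Q φ ψ) η i (D i) ∧ HasDPlus (valueFun Q φ ψ) η i (D i)) :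
    (∀ xη ∈ minSet Q φ ψ η, ∀ xη' ∈ minSet Q φ ψ η,
      (∀ i, ψ i xη = ψ i xη') ∧ φ xη = φ xη') ∧
    (∀ xη ∈ minSet Q φ ψ η,
      (∀ i, ψ i xη = D i) ∧ φ xη = valueFun Q φ ψ η - ∑ i, η i * D i) := by
  have hψD : ∀ x ∈ minSet Q φ ψ η, ∀ i, ψ i x = D i := fun x hx i =>
    le_antisymm ((hD i).1.ge_of_mem_minSet hφ hψ hη hx)
      ((hD i).2.le_of_mem_minSet hφ hψ (fun j => (hη j).le) hx)
  have hφD : ∀ x ∈ minSet Q φ ψ η, φ x = valueFun Q φ ψ η - ∑ i, η i * D i := fun x hx => by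
    simp [valueFun_eq_of_mem_minSet hx, hψD x hx]
  exact ⟨fun x hx y hy => ⟨fun i => (hψD x hx i).trans (hψD y hy i).symm,
    (hφD x hx).trans (hφD y hy).symm⟩, fun x hx => ⟨hψD x hx, hφD x hx⟩⟩
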